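/- Let p be an odd prime and R_λ = ⊕_{i=1}^k (ℤ/p^{λ_i}ℤ)^{ρ_i} the abelian p-group corresponding to λ = (λ_1^{ρ_1} > … > λ_k^{ρ_k}). For r = (r_1,…,r_k) with 1 ≤ r_i ≤ λ_i and a = (a_1,…,a_k) ∈ {0,1}^k, define the B-set I(r,a) = ∏_{i=1}^k p^{r_i}(R_{λ_i}^{ρ_i})^{(a_i)} ⊆ R_λ, where p^{r}(R_μ^{ρ})^{(0)} = p^{r}(ℤ/p^{μ}ℤ)^{ρ} and p^{r}(R_μ^{ρ})^{(1)} = p^{r}((ℤ/p^{μ}ℤ)^{ρ} \ p(ℤ/p^{μ}ℤ)^{ρ}). Then for any two B-sets, the sumset I(r,a) + I(s,b) = {u + v : u ∈ I(r,a), v ∈ I(s,b)} is again a B-set; precisely, I(r,a) + I(s,b) = I(min(r,s), c), where min(r,s) = (min(r_i,s_i))_i and c_i = a_i if r_i < s_i, c_i = b_i if r_i > s_i, and c_i = 0 if r_i = s_i (equivalently c = ½((a+b)·sgn(r−s) − (a−b))·sgn(r−s) componentwise). -/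

import Mathlib

open Pointwise

/-- The `B`-set `I(r,a) = ∏ᵢ p^{rᵢ}(R_{λᵢ}^{ρᵢ})^{(aᵢ)} ⊆ R_λ`, where
`p^{r}(R_μ^{ρ})^{(0)} = p^{r}(ℤ/p^{μ}ℤ)^{ρ}` and
`p^{r}(R_μ^{ρ})^{(1)} = p^{r}((ℤ/p^{μ}ℤ)^{ρ} \ p(ℤ/p^{μ}ℤ)^{ρ})`. -/
def BSet (p : ℕ) {k : ℕ} (lam rho : Fin k → ℕ) (r a : Fin k → ℕ) :
    Set (Π i : Fin k, Fin (rho i) → ZMod (p ^ lam i)) :=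
  { e | ∀ i : Fin k, ∃ c : Fin (rho i) → ZMod (p ^ lam i),
      e i = ((p : ZMod (p ^ lam i)) ^ r i) • c ∧
      (a i = 1 → ¬ ∃ d, c = (p : ZMod (p ^ lam i)) • d) }

/-- The multiples `x ^ r • c`, where `c` is required to be no multiple of `x` if `a = 1`. -/
def powSMulSet {R : Type*} (M : Type*) [CommRing R] [AddCommGroup M] [Module R M]
    (x : R) (r a : ℕ) : Set M :=
  {u | ∃ c, u = x ^ r • c ∧ (a = 1 → ¬ ∃ d, c = x • d)}

section

variable {R M : Type*} [CommRing R] [AddCommGroup M] [Module R M] {x : R} {e : M}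

theorem powSMulSet_add_of_lt (he : ¬ ∃ d, e = x • d) {r s : ℕ} (hrs : r < s) (a b : ℕ) :
    powSMulSet M x r a + powSMulSet M x s b = powSMulSet M x r a := by
  obtain ⟨n, rfl⟩ := Nat.exists_eq_add_of_lt hrs
  have key (d : M) : x ^ (r + n + 1) • d = x ^ r • x • x ^ n • d := by
    simp only [smul_smul]
    ring_nf
  ext w
  constructor
  · rintro ⟨_, ⟨c, rfl, hc⟩, _, ⟨d, rfl, -⟩, rfl⟩
    refine ⟨c + x • x ^ n • d, by simp only [smul_add, key], fun ha ⟨f, hf⟩ => hc ha ?_⟩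
    exact ⟨f - x ^ n • d, by rw [smul_sub, ← hf, add_sub_cancel_right]⟩
  · rintro ⟨c, rfl, hc⟩
    refine ⟨_, ⟨c - x • x ^ n • e, rfl, fun ha ⟨f, hf⟩ => hc ha ?_⟩, _, ⟨e, rfl, fun _ => he⟩, ?_⟩
    · exact ⟨f + x ^ n • e, by rw [smul_add, ← hf, sub_add_cancel]⟩
    · simp only [key, smul_sub, sub_add_cancel]

theorem powSMulSet_add_self (he : ¬ ∃ d, e = x • d) (h2e : ¬ ∃ d, e + e = x • d)
    (r a b : ℕ) :
    powSMulSet M x r a + powSMulSet M x r b = powSMulSet M x r 0 := by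
  ext w
  constructor
  · rintro ⟨_, ⟨c, rfl, -⟩, _, ⟨d, rfl, -⟩, rfl⟩
    exact ⟨c + d, (smul_add _ _ _).symm, by simp⟩
  · rintro ⟨c, rfl, -⟩
    by_cases h : ∃ d, c - e = x • d
    · obtain ⟨d, hd⟩ := h
      refine ⟨_, ⟨-e, rfl, fun _ ⟨f, hf⟩ => he ⟨-f, ?_⟩⟩, _,
        ⟨c + e, rfl, fun _ ⟨f, hf⟩ => h2e ⟨f - d, ?_⟩⟩, ?_⟩
      · rw [smul_neg, ← hf, neg_neg]
      · rw [smul_sub, ← hf, ← hd]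
        abel
      · simp only [← smul_add, add_comm c e, neg_add_cancel_left]
    · exact ⟨_, ⟨e, rfl, fun _ => he⟩, _, ⟨c - e, rfl, fun _ => h⟩, by
        simp only [← smul_add, add_sub_cancel]⟩

theorem powSMulSet_add (he : ¬ ∃ d, e = x • d) (h2e : ¬ ∃ d, e + e = x • d)
    (r s a b : ℕ) :
    powSMulSet M x r a + powSMulSet M x s b =
      powSMulSet M x (min r s) (if r < s then a else if s < r then b else 0) := by
  rcases lt_trichotomy r s with h | rfl | h
  · rw [powSMulSet_add_of_lt he h, min_eq_left h.le, if_pos h]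
  · simpa using powSMulSet_add_self he h2e r a b
  · rw [add_comm, powSMulSet_add_of_lt he h, min_eq_right h.le, if_neg h.not_gt, if_pos h]

end

theorem ZMod.not_natCast_prime_dvd {p n m : ℕ} (hn : 0 < n) (hm : ¬ p ∣ m) :
    ¬ (p : ZMod (p ^ n)) ∣ (m : ZMod (p ^ n)) := by
  intro h
  have h' := map_dvd (ZMod.castHom (dvd_pow_self p hn.ne') (ZMod p)) h
  rw [map_natCast, map_natCast, ZMod.natCast_self, zero_dvd_iff, ZMod.natCast_eq_zero_iff] at h'
  exact hm h'

theorem bSet_eq_pi (p : ℕ) {k : ℕ} (lam rho r a : Fin k → ℕ) :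
    BSet p lam rho r a = Set.univ.pi fun i =>
      powSMulSet (Fin (rho i) → ZMod (p ^ lam i)) (p : ZMod (p ^ lam i)) (r i) (a i) := by
  ext u
  simp [BSet, powSMulSet, Set.mem_pi]

theorem Set.univ_pi_add_univ_pi {ι : Type*} {M : ι → Type*} [∀ i, Add (M i)]
    (s t : ∀ i, Set (M i)) :
    Set.univ.pi s + Set.univ.pi t = Set.univ.pi fun i => s i + t i := by
  ext w
  constructor
  · rintro ⟨u, hu, v, hv, rfl⟩ i hi
    exact Set.add_mem_add (hu i hi) (hv i hi)
  · intro hw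
    choose u hu v hv huv using fun i => hw i (Set.mem_univ i)
    exact ⟨u, fun i _ => hu i, v, fun i _ => hv i, funext huv⟩

/-- **Sum of two B-sets is a B-set.**
For an odd prime `p`, `I(r,a) + I(s,b) = I(min(r,s), c)` where `cᵢ = aᵢ` if
`rᵢ < sᵢ`, `cᵢ = bᵢ` if `rᵢ > sᵢ`, and `cᵢ = 0` if `rᵢ = sᵢ`. -/
theorem bSet_add_bSet
    (p : ℕ) (hp : p.Prime) (hodd : Odd p)
    (k : ℕ) (lam rho : Fin k → ℕ)
    (hlam : StrictAnti lam) (hlampos : ∀ i, 0 < lam i) (hrho : ∀ i, 0 < rho i)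
    (r s : Fin k → ℕ)
    (hr : ∀ i, 1 ≤ r i ∧ r i ≤ lam i) (hs : ∀ i, 1 ≤ s i ∧ s i ≤ lam i)
    (a b : Fin k → ℕ) (ha : ∀ i, a i ≤ 1) (hb : ∀ i, b i ≤ 1) :
    BSet p lam rho r a + BSet p lam rho s b =
      BSet p lam rho (fun i => min (r i) (s i))
        (fun i => if r i < s i then a i else if s i < r i then b i else 0) := by
  have hp2 : ¬ p ∣ 2 := fun h => by
    rw [(Nat.prime_dvd_prime_iff_eq hp Nat.prime_two).1 h] at hodd
    exact absurd hodd (by decide)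
  simp only [bSet_eq_pi, Set.univ_pi_add_univ_pi]
  congr 1
  funext i
  refine powSMulSet_add (e := 1) ?_ ?_ _ _ _ _
  · rintro ⟨d, hd⟩
    refine ZMod.not_natCast_prime_dvd (hlampos i) hp.not_dvd_one ⟨d ⟨0, hrho i⟩, ?_⟩
    simpa using congrFun hd ⟨0, hrho i⟩
  · rintro ⟨d, hd⟩
    refine ZMod.not_natCast_prime_dvd (hlampos i) hp2 ⟨d ⟨0, hrho i⟩, ?_⟩
    simpa [one_add_one_eq_two] using congrFun hd ⟨0, hrho i⟩
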